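/- Let Ω be a nonempty finite set and let σ : Ω × Ω → {0,1} be symmetric (σ(x,y) = σ(y,x)) with p := E_{x,y i.i.d. Unif(Ω)}[σ(x,y)] > 0. Then for x₁, x₂, x₃, x₄ i.i.d. uniform on Ω, the expected signed 4-cycle satisfies E[ (σ(x₁,x₂)−p)(σ(x₂,x₃)−p)(σ(x₃,x₄)−p)(σ(x₄,x₁)−p) ] ≥ (1−p)⁴ / |Ω|⁴. -/

import Mathlib

open Finset

noncomputable section

/-- The trace of the fourth power of a symmetric matrix is at least the fourth power of any entry. -/
theorem pow_four_le_sum_four_cycle {ι : Type*} [Fintype ι] (M : ι → ι → ℝ)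
    (hM : ∀ x y, M x y = M y x) (a b : ι) :
    M a b ^ 4 ≤ ∑ x₁, ∑ x₂, ∑ x₃, ∑ x₄, M x₁ x₂ * M x₂ x₃ * M x₃ x₄ * M x₄ x₁ := by
  have hsq : ∑ x₁, ∑ x₂, ∑ x₃, ∑ x₄, M x₁ x₂ * M x₂ x₃ * M x₃ x₄ * M x₄ x₁ =
      ∑ x, ∑ z, (∑ y, M x y * M y z) ^ 2 := by
    refine Finset.sum_congr rfl fun x _ => ?_
    rw [Finset.sum_comm]
    refine Finset.sum_congr rfl fun z _ => ?_
    rw [sq, Finset.sum_mul_sum]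
    refine Finset.sum_congr rfl fun y _ => Finset.sum_congr rfl fun w _ => ?_
    rw [hM z w, hM w x]
    ring
  have hdiag : M a b ^ 2 ≤ ∑ y, M a y * M y a := by
    calc M a b ^ 2 = M a b * M b a := by rw [hM b a, sq]
      _ ≤ ∑ y, M a y * M y a :=
        Finset.single_le_sum (f := fun y => M a y * M y a)
          (fun y _ => by rw [hM y a]; exact mul_self_nonneg _) (Finset.mem_univ b)
  rw [hsq]
  calc M a b ^ 4 = (M a b ^ 2) ^ 2 := by ring
    _ ≤ (∑ y, M a y * M y a) ^ 2 := by gcongr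
    _ ≤ ∑ z, (∑ y, M a y * M y z) ^ 2 :=
      Finset.single_le_sum (f := fun z => (∑ y, M a y * M y z) ^ 2)
        (fun _ _ => sq_nonneg _) (Finset.mem_univ a)
    _ ≤ ∑ x, ∑ z, (∑ y, M x y * M y z) ^ 2 :=
      Finset.single_le_sum (f := fun x => ∑ z, (∑ y, M x y * M y z) ^ 2)
        (fun _ _ => Finset.sum_nonneg fun _ _ => sq_nonneg _) (Finset.mem_univ a)

/-- The expected signed 4-cycle of a symmetric `{0,1}`-valued connection `σ` on a finite
latent space `Ω` with mean `p > 0` is at least `(1−p)⁴/|Ω|⁴` (from the proof of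
Theorem `signedfourcyclesforrag`). -/
theorem expected_signed_four_cycle_lower_bound
    (Ω : Type) [Fintype Ω] [Nonempty Ω] (σ : Ω → Ω → ℝ)
    (hsymm : ∀ x y, σ x y = σ y x)
    (h01 : ∀ x y, σ x y = 0 ∨ σ x y = 1)
    (p : ℝ) (hp : p = (∑ x : Ω, ∑ y : Ω, σ x y) / (Fintype.card Ω : ℝ) ^ 2)
    (hppos : 0 < p) :
    (1 - p) ^ 4 / (Fintype.card Ω : ℝ) ^ 4 ≤
      (∑ x₁ : Ω, ∑ x₂ : Ω, ∑ x₃ : Ω, ∑ x₄ : Ω,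
          (σ x₁ x₂ - p) * (σ x₂ x₃ - p) * (σ x₃ x₄ - p) * (σ x₄ x₁ - p)) /
        (Fintype.card Ω : ℝ) ^ 4 := by
  obtain ⟨a, b, hab⟩ : ∃ a b, σ a b = 1 := by
    by_contra! h
    have h0 : ∀ x y, σ x y = 0 := fun x y => (h01 x y).resolve_right (h x y)
    simp [hp, h0] at hppos
  have key := pow_four_le_sum_four_cycle (fun x y => σ x y - p)
    (fun x y => by rw [hsymm x y]) a b
  simp only [hab] at key
  gcongr
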